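/- Assume α_T = ∑_t ℓ_{0,t} > 0. Then the derivative λ_e′ of the charging unit price is nondecreasing on [0, ∞) and strictly increasing on [0, L_e^{(T−1)}); equivalently, λ_e is convex on [0, ∞) and strictly convex on [0, L_e^{(T−1)}]. -/

import Mathlib

open Finset

/-- Total electricity cost of a charging profile `ℓe` over time slots `1,…,T`,
with cost functions `f_t(ℓ) = η_t ℓ^n`. -/
noncomputable def chargCost (T : ℕ) (n : ℝ) (η ℓ0 ℓe : ℕ → ℝ) : ℝ :=
  ∑ t ∈ Finset.Icc 1 T, η t * (ℓ0 t + ℓe t) ^ n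

/-- Feasibility of a charging profile: nonnegative, and summing to the charging need `Le`. -/
def ChargFeasible (T : ℕ) (Le : ℝ) (ℓe : ℕ → ℝ) : Prop :=
  (∀ t ∈ Finset.Icc 1 T, 0 ≤ ℓe t) ∧ ∑ t ∈ Finset.Icc 1 T, ℓe t = Le

/-- Optimal charging cost `V(L_e)`. -/
noncomputable def Vopt (T : ℕ) (n : ℝ) (η ℓ0 : ℕ → ℝ) (Le : ℝ) : ℝ :=
  sInf {c | ∃ ℓe, ChargFeasible T Le ℓe ∧ chargCost T n η ℓ0 ℓe = c}

/-- Cumulative nonflexible load `α_t = ∑_{s=1}^t ℓ_{0,s}`. -/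
noncomputable def alphaC (ℓ0 : ℕ → ℝ) (t : ℕ) : ℝ := ∑ s ∈ Finset.Icc 1 t, ℓ0 s

/-- Cost of the nonflexible load after time `t`: `β_t = ∑_{s=t+1}^T f_s(ℓ_{0,s})`. -/
noncomputable def betaC (T : ℕ) (n : ℝ) (η ℓ0 : ℕ → ℝ) (t : ℕ) : ℝ :=
  ∑ s ∈ Finset.Icc (t + 1) T, η s * ℓ0 s ^ n

/-- Energy thresholds `L_e^{(t)}` (for `0 ≤ t ≤ T-1`, with `L_e^{(0)} = 0`). -/
noncomputable def Lth (n : ℝ) (η ℓ0 : ℕ → ℝ) (t : ℕ) : ℝ :=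
  if t = 0 then 0
  else (∑ s ∈ Finset.Icc 1 t, (η (t + 1) / η s) ^ (1 / (n - 1))) * ℓ0 (t + 1) - alphaC ℓ0 t

/-- Charging unit price `λ_e(L_e) = V(L_e) / (L_e + α_T)`. -/
noncomputable def lamE (T : ℕ) (n : ℝ) (η ℓ0 : ℕ → ℝ) (Le : ℝ) : ℝ :=
  Vopt T n η ℓ0 Le / (Le + alphaC ℓ0 T)

/-- The tangent line inequality for `x ↦ x ^ n` on the nonnegative reals. -/
theorem rpow_tangent_le {n a b : ℝ} (hn : 2 ≤ n) (ha : 0 ≤ a) (hb : 0 ≤ b) :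
    b ^ n + n * b ^ (n - 1) * (a - b) ≤ a ^ n := by
  rcases hb.eq_or_lt with rfl | hb
  · rw [Real.zero_rpow (by linarith), Real.zero_rpow (by linarith)]
    simpa using Real.rpow_nonneg ha n
  · have h := one_add_mul_self_le_rpow_one_add (s := a / b - 1) (p := n)
      (by have : 0 ≤ a / b := by positivity
          linarith) (by linarith)
    rw [add_sub_cancel, Real.div_rpow ha hb.le, le_div_iff₀ (by positivity)] at h
    have hb' : b ^ n = b ^ (n - 1) * b := by
      rw [← Real.rpow_add_one hb.ne', sub_add_cancel]
    calc b ^ n + n * b ^ (n - 1) * (a - b) = (1 + n * (a / b - 1)) * b ^ n := by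
          rw [hb']; field_simp
      _ ≤ a ^ n := h

/-- Joint convexity of `(u, x) ↦ u ^ n / x` for `n ≥ 2`. -/
theorem rpow_div_jointly_convex {n a b u v x y : ℝ} (hn : 2 ≤ n) (hu : 0 ≤ u) (hv : 0 ≤ v)
    (hx : 0 < x) (hy : 0 < y) (ha : 0 < a) (hb : 0 < b) (hab : a + b = 1) :
    (a * u + b * v) ^ n / (a * x + b * y) ≤ a * (u ^ n / x) + b * (v ^ n / y) := by
  have key : ∀ w : ℝ, 0 ≤ w → w ^ n = (w ^ (n / 2)) ^ 2 := fun w hw => by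
    rw [← Real.rpow_natCast, ← Real.rpow_mul hw]; norm_num
  have h1 : (a * u + b * v) ^ (n / 2) ≤ a * u ^ (n / 2) + b * v ^ (n / 2) := by
    simpa using (convexOn_rpow (p := n / 2) (by linarith)).2 hu hv ha.le hb.le hab
  have huv : 0 ≤ a * u + b * v := by positivity
  rw [key _ huv, key _ hu, key _ hv]
  set p := u ^ (n / 2)
  set q := v ^ (n / 2)
  have h0 : 0 ≤ (a * u + b * v) ^ (n / 2) := Real.rpow_nonneg huv _
  calc ((a * u + b * v) ^ (n / 2)) ^ 2 / (a * x + b * y)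
      ≤ (a * p + b * q) ^ 2 / (a * x + b * y) := by gcongr
    _ ≤ a * (p ^ 2 / x) + b * (q ^ 2 / y) := by
      have e : a * (p ^ 2 / x) + b * (q ^ 2 / y) - (a * p + b * q) ^ 2 / (a * x + b * y)
          = a * b * (p * y - q * x) ^ 2 / (x * y * (a * x + b * y)) := by
        field_simp
        ring
      have : 0 ≤ a * b * (p * y - q * x) ^ 2 / (x * y * (a * x + b * y)) := by positivity
      linarith

/-- Strict convexity of `x ↦ c / x` on the positive reals, for `c > 0`. -/
theorem const_div_strict_convex {a b c x y : ℝ} (hc : 0 < c)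
    (hx : 0 < x) (hy : 0 < y) (hxy : x ≠ y) (ha : 0 < a) (hb : 0 < b) (hab : a + b = 1) :
    c / (a * x + b * y) < a * (c / x) + b * (c / y) := by
  have e : a * (c / x) + b * (c / y) - c / (a * x + b * y)
      = c * (a * b * (x - y) ^ 2) / (x * y * (a * x + b * y)) := by
    obtain rfl : b = 1 - a := by linarith
    have : a * x + (1 - a) * y ≠ 0 := by positivity
    field_simp
    ring
  have h2 : 0 < (x - y) ^ 2 := by
    have := sub_ne_zero.2 hxy
    positivity
  have : 0 < c * (a * b * (x - y) ^ 2) / (x * y * (a * x + b * y)) := by positivity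
  linarith

/-- An optimal charging profile exists and attains `Vopt`. -/
theorem exists_optimal_profile {T : ℕ} {n L : ℝ} {η ℓ0 : ℕ → ℝ} (hT : 1 ≤ T) (hn : 0 ≤ n)
    (hL : 0 ≤ L) :
    ∃ ℓe, ChargFeasible T L ℓe ∧ Vopt T n η ℓ0 L = chargCost T n η ℓ0 ℓe ∧
      ∀ ℓ, ChargFeasible T L ℓ → chargCost T n η ℓ0 ℓe ≤ chargCost T n η ℓ0 ℓ := by
  have hsum : Continuous fun ℓ : ℕ → ℝ => ∑ t ∈ Icc 1 T, ℓ t :=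
    continuous_finsetSum _ fun t _ => continuous_apply t
  have hcost : Continuous (chargCost T n η ℓ0) := by
    refine continuous_finsetSum _ fun t _ => continuous_const.mul ?_
    exact (continuous_const.add (continuous_apply t)).rpow_const fun _ => Or.inr hn
  have hK : IsCompact ((Set.univ.pi fun _ : ℕ => Set.Icc 0 L) ∩
      {ℓ : ℕ → ℝ | ∑ t ∈ Icc 1 T, ℓ t = L}) :=
    (isCompact_univ_pi fun _ => isCompact_Icc).inter_right (isClosed_eq hsum continuous_const)
  have hne : ((Set.univ.pi fun _ : ℕ => Set.Icc 0 L) ∩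
      {ℓ : ℕ → ℝ | ∑ t ∈ Icc 1 T, ℓ t = L}).Nonempty := by
    refine ⟨fun t => if t = 1 then L else 0, fun t _ => ?_, ?_⟩
    · dsimp only
      split_ifs <;> simp [hL]
    · simp [Finset.sum_ite_eq', hT]
  obtain ⟨ℓe, ⟨hpi, hs⟩, hmin⟩ := hK.exists_isMinOn hne hcost.continuousOn
  have hf : ChargFeasible T L ℓe := ⟨fun t _ => (hpi t trivial).1, hs⟩
  have hopt : ∀ ℓ, ChargFeasible T L ℓ → chargCost T n η ℓ0 ℓe ≤ chargCost T n η ℓ0 ℓ := by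
    intro ℓ hℓ
    have hmem : (fun t => if t ∈ Icc 1 T then ℓ t else 0) ∈
        (Set.univ.pi fun _ : ℕ => Set.Icc 0 L) ∩ {ℓ : ℕ → ℝ | ∑ t ∈ Icc 1 T, ℓ t = L} := by
      refine ⟨fun t _ => ?_, ?_⟩
      · dsimp only
        split_ifs with h
        · exact ⟨hℓ.1 t h, hℓ.2 ▸ Finset.single_le_sum (f := ℓ) hℓ.1 h⟩
        · exact ⟨le_rfl, hL⟩
      · exact (Finset.sum_congr rfl fun t ht => if_pos ht).trans hℓ.2
    refine (hmin hmem).trans_eq (Finset.sum_congr rfl fun t ht => ?_)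
    simp only [if_pos ht]
  refine ⟨ℓe, hf, ?_, hopt⟩
  refine IsLeast.csInf_eq ⟨⟨ℓe, hf, rfl⟩, ?_⟩
  rintro _ ⟨ℓ, hℓ, rfl⟩
  exact hopt ℓ hℓ

/-- `Vopt` is a lower bound for the cost of every feasible profile. -/
theorem Vopt_le_chargCost {T : ℕ} {n L : ℝ} {η ℓ0 ℓ : ℕ → ℝ}
    (hη : ∀ t ∈ Icc 1 T, 0 < η t) (hℓ0 : ∀ t ∈ Icc 1 T, 0 ≤ ℓ0 t)
    (hℓ : ChargFeasible T L ℓ) : Vopt T n η ℓ0 L ≤ chargCost T n η ℓ0 ℓ := by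
  refine csInf_le ⟨0, ?_⟩ ⟨ℓ, hℓ, rfl⟩
  rintro _ ⟨ℓ', hℓ', rfl⟩
  exact Finset.sum_nonneg fun t ht =>
    mul_nonneg (hη t ht).le (Real.rpow_nonneg (add_nonneg (hℓ0 t ht) (hℓ'.1 t ht)) _)

/-- Moving a small amount of load from a slot with larger marginal cost to a slot with smaller
marginal cost strictly decreases the total cost of the two slots. -/
theorem exists_transfer_cost_lt {n p q u v m w : ℝ} (hn : 2 ≤ n) (hp : 0 < p) (hq : 0 < q)
    (hu : 0 ≤ u) (hw : 0 ≤ w) (hum : u < m) (hwv : w < v)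
    (hm : p * m ^ (n - 1) = q * w ^ (n - 1)) :
    ∃ ε, 0 < ε ∧ ε ≤ v - w ∧ p * (u + ε) ^ n + q * (v - ε) ^ n < p * u ^ n + q * v ^ n := by
  obtain ⟨ε, hε, h1, h2⟩ : ∃ ε, 0 < ε ∧ u + ε ≤ m ∧ w < v - ε :=
    ⟨min (m - u) ((v - w) / 2), by apply lt_min <;> linarith,
      by linarith [min_le_left (m - u) ((v - w) / 2)],
      by linarith [min_le_right (m - u) ((v - w) / 2)]⟩
  refine ⟨ε, hε, by linarith, ?_⟩
  have t1 := rpow_tangent_le (a := u) (b := u + ε) hn hu (by linarith)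
  have t2 := rpow_tangent_le (a := v) (b := v - ε) hn (by linarith) (by linarith)
  have m1 : p * (u + ε) ^ (n - 1) ≤ p * m ^ (n - 1) :=
    mul_le_mul_of_nonneg_left
      (Real.rpow_le_rpow (by linarith) h1 (by linarith)) hp.le
  have m2 : q * w ^ (n - 1) < q * (v - ε) ^ (n - 1) :=
    mul_lt_mul_of_pos_left (Real.rpow_lt_rpow hw h2 (by linarith)) hq
  have m3 : 0 < n * ε * (q * (v - ε) ^ (n - 1) - p * (u + ε) ^ (n - 1)) :=
    mul_pos (by positivity) (by linarith)
  have t1' := mul_le_mul_of_nonneg_left t1 hp.le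
  have t2' := mul_le_mul_of_nonneg_left t2 hq.le
  nlinarith

/-- Below the last energy threshold, an optimal profile does not charge in the last slot. -/
theorem optimal_last_eq_zero {T : ℕ} {n L : ℝ} {η ℓ0 ℓe : ℕ → ℝ} (hT : 2 ≤ T) (hn : 2 ≤ n)
    (hη : ∀ t ∈ Icc 1 T, 0 < η t) (hℓ0 : ∀ t ∈ Icc 1 T, 0 ≤ ℓ0 t)
    (hL : L ≤ Lth n η ℓ0 (T - 1)) (hf : ChargFeasible T L ℓe)
    (hopt : ∀ ℓ, ChargFeasible T L ℓ → chargCost T n η ℓ0 ℓe ≤ chargCost T n η ℓ0 ℓ) :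
    ℓe T = 0 := by
  obtain ⟨k, rfl⟩ : ∃ k, T = k + 1 := ⟨T - 1, by omega⟩
  have hk : k ≠ 0 := by omega
  have hTm : k + 1 ∈ Icc 1 (k + 1) := by simp
  by_contra hne
  have hpos : 0 < ℓe (k + 1) := lt_of_le_of_ne (hf.1 _ hTm) (Ne.symm hne)
  rw [Nat.add_sub_cancel, Lth, if_neg hk, alphaC, Finset.sum_mul] at hL
  have hsum := hf.2
  rw [Finset.sum_Icc_succ_top (by omega)] at hsum
  have hlt : ∑ s ∈ Icc 1 k, (ℓ0 s + ℓe s) <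
      ∑ s ∈ Icc 1 k, (η (k + 1) / η s) ^ (1 / (n - 1)) * ℓ0 (k + 1) := by
    rw [Finset.sum_add_distrib]
    linarith
  obtain ⟨s, hs, hslt⟩ := Finset.exists_lt_of_sum_lt hlt
  have hs' : s ∈ Icc 1 (k + 1) := by
    simp only [Finset.mem_Icc] at hs ⊢
    omega
  have hsk : s ≠ k + 1 := by
    simp only [Finset.mem_Icc] at hs
    omega
  have hηs := hη s hs'
  have hηT := hη _ hTm
  have hm : η s * ((η (k + 1) / η s) ^ (1 / (n - 1)) * ℓ0 (k + 1)) ^ (n - 1) =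
      η (k + 1) * ℓ0 (k + 1) ^ (n - 1) := by
    rw [Real.mul_rpow (by positivity) (hℓ0 _ hTm), ← Real.rpow_mul (by positivity),
      one_div_mul_cancel (by linarith), Real.rpow_one]
    field_simp
  obtain ⟨ε, hε, hεle, hcost⟩ := exists_transfer_cost_lt hn hηs hηT
    (add_nonneg (hℓ0 s hs') (hf.1 s hs')) (hℓ0 _ hTm) hslt
    (lt_add_of_pos_right (ℓ0 (k + 1)) hpos) hm
  set ℓ : ℕ → ℝ := fun t => if t = s then ℓe t + ε else if t = k + 1 then ℓe t - ε else ℓe t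
    with hℓ
  have split : ∀ g : ℕ → ℝ, ∑ t ∈ Icc 1 (k + 1), g t =
      g s + g (k + 1) + ∑ t ∈ ((Icc 1 (k + 1)).erase s).erase (k + 1), g t := fun g => by
    rw [add_assoc, Finset.add_sum_erase _ g (Finset.mem_erase.2 ⟨hsk.symm, hTm⟩),
      Finset.add_sum_erase _ g hs']
  have hℓs : ℓ s = ℓe s + ε := by simp [hℓ]
  have hℓT : ℓ (k + 1) = ℓe (k + 1) - ε := by simp [hℓ, hsk.symm]
  have hrest : ∀ t ∈ ((Icc 1 (k + 1)).erase s).erase (k + 1), ℓ t = ℓe t := fun t ht => by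
    rw [Finset.mem_erase, Finset.mem_erase] at ht
    simp [hℓ, ht.1, ht.2.1]
  have hfeas : ChargFeasible (k + 1) L ℓ := by
    refine ⟨fun t ht => ?_, ?_⟩
    · have := hf.1 t ht
      by_cases h1 : t = s
      · rw [h1] at this ⊢
        rw [hℓs]
        linarith
      · by_cases h2 : t = k + 1
        · rw [h2, hℓT]
          linarith
        · rwa [hrest t (by simp only [Finset.mem_erase]; exact ⟨h2, h1, ht⟩)]
    · rw [← hf.2, split ℓ, split ℓe, hℓs, hℓT, Finset.sum_congr rfl hrest]
      ring
  have := hopt ℓ hfeas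
  rw [chargCost, chargCost, split, split, hℓs, hℓT, ← add_assoc, ← add_sub_assoc] at this
  have hr : ∑ t ∈ ((Icc 1 (k + 1)).erase s).erase (k + 1), η t * (ℓ0 t + ℓ t) ^ n =
      ∑ t ∈ ((Icc 1 (k + 1)).erase s).erase (k + 1), η t * (ℓ0 t + ℓe t) ^ n :=
    Finset.sum_congr rfl fun t ht => by rw [hrest t ht]
  linarith

/-- Convex combinations of feasible profiles are feasible for the combined charging need. -/
theorem ChargFeasible.combo {T : ℕ} {L M a b : ℝ} {ℓ m : ℕ → ℝ} (hℓ : ChargFeasible T L ℓ)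
    (hm : ChargFeasible T M m) (ha : 0 ≤ a) (hb : 0 ≤ b) :
    ChargFeasible T (a * L + b * M) fun t => a * ℓ t + b * m t := by
  refine ⟨fun t ht => add_nonneg (mul_nonneg ha (hℓ.1 t ht)) (mul_nonneg hb (hm.1 t ht)), ?_⟩
  rw [Finset.sum_add_distrib, ← Finset.mul_sum, ← Finset.mul_sum, hℓ.2, hm.2]

/-- If the total nonflexible load is positive, so is the load of the slot with largest
marginal cost. -/
theorem last_load_pos {T : ℕ} {n : ℝ} {η ℓ0 : ℕ → ℝ} (hT : 1 ≤ T) (hn : 1 < n)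
    (hη : ∀ t ∈ Icc 1 T, 0 < η t) (hℓ0 : ∀ t ∈ Icc 1 T, 0 ≤ ℓ0 t)
    (hord : ∀ s t : ℕ, 1 ≤ s → s ≤ t → t ≤ T →
      η s * ℓ0 s ^ (n - 1) ≤ η t * ℓ0 t ^ (n - 1))
    (hα : 0 < alphaC ℓ0 T) : 0 < ℓ0 T := by
  have hTm : T ∈ Icc 1 T := by simp [hT]
  refine lt_of_le_of_ne (hℓ0 T hTm) fun h0 => hα.ne' (Finset.sum_eq_zero fun s hs => ?_)
  have hb := Finset.mem_Icc.1 hs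
  have h := hord s T hb.1 hb.2 le_rfl
  rw [← h0, Real.zero_rpow (by linarith), mul_zero] at h
  by_contra hne
  have : 0 < ℓ0 s := lt_of_le_of_ne (hℓ0 s hs) (Ne.symm hne)
  have : 0 < η s * ℓ0 s ^ (n - 1) := mul_pos (hη s hs) (Real.rpow_pos_of_pos this _)
  linarith

/-- if `α_T > 0`, the derivative of the charging unit price `λ_e` is
nondecreasing on `[0, ∞)` and strictly increasing on `[0, L_e^{(T-1)})`; equivalently,
`λ_e` is convex on `[0, ∞)` and strictly convex on `[0, L_e^{(T-1)}]`. -/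
theorem lamE_convex
    (T : ℕ) (n : ℝ) (η ℓ0 : ℕ → ℝ)
    (hT : 2 ≤ T) (hn : (2 : ℝ) ≤ n)
    (hη : ∀ t ∈ Finset.Icc 1 T, 0 < η t)
    (hℓ0 : ∀ t ∈ Finset.Icc 1 T, 0 ≤ ℓ0 t)
    (hord : ∀ s t : ℕ, 1 ≤ s → s ≤ t → t ≤ T →
      η s * ℓ0 s ^ (n - 1) ≤ η t * ℓ0 t ^ (n - 1))
    (hα : 0 < alphaC ℓ0 T) :
    ConvexOn ℝ (Set.Ici 0) (lamE T n η ℓ0) ∧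
    StrictConvexOn ℝ (Set.Icc 0 (Lth n η ℓ0 (T - 1))) (lamE T n η ℓ0) := by
  have hn0 : 0 ≤ n := by linarith
  have hTm : T ∈ Finset.Icc 1 T := Finset.mem_Icc.2 ⟨by omega, le_rfl⟩
  have hpos : ∀ L : ℝ, 0 ≤ L → 0 < L + alphaC ℓ0 T := fun L hL => by linarith
  have hcomb : ∀ {a b : ℝ} (L M : ℝ), a + b = 1 → a * L + b * M + alphaC ℓ0 T =
      a * (L + alphaC ℓ0 T) + b * (M + alphaC ℓ0 T) := fun {a b} L M hab => by
    linear_combination (-alphaC ℓ0 T) * hab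
  have hterm : ∀ {a b L M : ℝ} {ℓ m : ℕ → ℝ}, 0 < a → 0 < b → a + b = 1 → 0 ≤ L → 0 ≤ M →
      ChargFeasible T L ℓ → ChargFeasible T M m → ∀ t ∈ Finset.Icc 1 T,
      η t * (ℓ0 t + (a * ℓ t + b * m t)) ^ n / (a * L + b * M + alphaC ℓ0 T) ≤
        a * (η t * (ℓ0 t + ℓ t) ^ n / (L + alphaC ℓ0 T)) +
          b * (η t * (ℓ0 t + m t) ^ n / (M + alphaC ℓ0 T)) := by
    intro a b L M ℓ m ha hb hab hL hM hℓ hm t ht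
    have h := rpow_div_jointly_convex hn (add_nonneg (hℓ0 t ht) (hℓ.1 t ht))
      (add_nonneg (hℓ0 t ht) (hm.1 t ht)) (hpos L hL) (hpos M hM) ha hb hab
    have e : ℓ0 t + (a * ℓ t + b * m t) = a * (ℓ0 t + ℓ t) + b * (ℓ0 t + m t) := by
      linear_combination (-ℓ0 t) * hab
    rw [hcomb L M hab, e]
    calc _ = η t * ((a * (ℓ0 t + ℓ t) + b * (ℓ0 t + m t)) ^ n /
          (a * (L + alphaC ℓ0 T) + b * (M + alphaC ℓ0 T))) := by ring
      _ ≤ _ := mul_le_mul_of_nonneg_left h (hη t ht).le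
      _ = _ := by ring
  have hle : ∀ {a b L M : ℝ} {ℓ m : ℕ → ℝ}, 0 < a → 0 < b → 0 ≤ L → 0 ≤ M →
      ChargFeasible T L ℓ → ChargFeasible T M m → lamE T n η ℓ0 (a * L + b * M) ≤
        ∑ t ∈ Finset.Icc 1 T,
          η t * (ℓ0 t + (a * ℓ t + b * m t)) ^ n / (a * L + b * M + alphaC ℓ0 T) := by
    intro a b L M ℓ m ha hb hL hM hℓ hm
    rw [← Finset.sum_div]
    exact div_le_div_of_nonneg_right
      (Vopt_le_chargCost hη hℓ0 (hℓ.combo hm ha.le hb.le)) (hpos _ (by positivity)).le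
  have hlam : ∀ {a b L M : ℝ} {ℓ m : ℕ → ℝ}, Vopt T n η ℓ0 L = chargCost T n η ℓ0 ℓ →
      Vopt T n η ℓ0 M = chargCost T n η ℓ0 m →
      a * lamE T n η ℓ0 L + b * lamE T n η ℓ0 M = ∑ t ∈ Finset.Icc 1 T,
        (a * (η t * (ℓ0 t + ℓ t) ^ n / (L + alphaC ℓ0 T)) +
          b * (η t * (ℓ0 t + m t) ^ n / (M + alphaC ℓ0 T))) := by
    intro a b L M ℓ m hVL hVM
    rw [Finset.sum_add_distrib, ← Finset.mul_sum, ← Finset.mul_sum, ← Finset.sum_div,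
      ← Finset.sum_div, lamE, lamE, hVL, hVM, chargCost, chargCost]
  constructor
  · refine convexOn_iff_forall_pos.2 ⟨convex_Ici 0, ?_⟩
    intro L hL M hM a b ha hb hab
    rw [Set.mem_Ici] at hL hM
    obtain ⟨ℓ, hℓ, hVL, -⟩ := exists_optimal_profile (η := η) (ℓ0 := ℓ0)
      (by omega : 1 ≤ T) hn0 hL
    obtain ⟨m, hm, hVM, -⟩ := exists_optimal_profile (η := η) (ℓ0 := ℓ0)
      (by omega : 1 ≤ T) hn0 hM
    simp only [smul_eq_mul]
    rw [hlam hVL hVM]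
    exact (hle ha hb hL hM hℓ hm).trans
      (Finset.sum_le_sum (hterm ha hb hab hL hM hℓ hm))
  · refine ⟨convex_Icc _ _, ?_⟩
    intro L hL M hM hne a b ha hb hab
    obtain ⟨ℓ, hℓ, hVL, hℓopt⟩ := exists_optimal_profile (η := η) (ℓ0 := ℓ0)
      (by omega : 1 ≤ T) hn0 hL.1
    obtain ⟨m, hm, hVM, hmopt⟩ := exists_optimal_profile (η := η) (ℓ0 := ℓ0)
      (by omega : 1 ≤ T) hn0 hM.1
    simp only [smul_eq_mul]
    rw [hlam hVL hVM]
    refine (hle ha hb hL.1 hM.1 hℓ hm).trans_lt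
      (Finset.sum_lt_sum (hterm ha hb hab hL.1 hM.1 hℓ hm) ⟨T, hTm, ?_⟩)
    rw [optimal_last_eq_zero hT hn hη hℓ0 hL.2 hℓ hℓopt,
      optimal_last_eq_zero hT hn hη hℓ0 hM.2 hm hmopt, hcomb L M hab]
    simp only [mul_zero, add_zero]
    have hlast := last_load_pos (by omega) (by linarith) hη hℓ0 hord hα
    exact const_div_strict_convex (mul_pos (hη T hTm) (Real.rpow_pos_of_pos hlast n))
      (hpos L hL.1) (hpos M hM.1) (fun h => hne (add_right_cancel h)) ha hb hab
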